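/- Let f : ℝⁿ → ℂ be a continuous function vanishing at infinity and let k ∈ L¹(ℝⁿ). Then the bounded operator on L²(ℝⁿ) given by η ↦ f·(k ∗ η) (pointwise multiplication by f composed with convolution by k) is a compact operator. (This is the content of Theorem A.4: the index asymptotic morphism Φ_t takes values in the compact operators K(L²ℝⁿ).) -/

import Mathlib

open MeasureTheory Filter
open scoped ENNReal

section
variable {V : Type*} [NormedAddCommGroup V] [NormedSpace ℝ V] [FiniteDimensional ℝ V]
  [MeasurableSpace V] [BorelSpace V] {μ : Measure V} [μ.IsAddHaarMeasure]

lemma aemeasurable_convolution_integrand {a b : V → ℝ≥0∞} (ha : AEMeasurable a μ)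
    (hb : AEMeasurable b μ) :
    AEMeasurable (fun p : V × V => a (p.1 - p.2) * b p.2) (μ.prod μ) :=
  (ha.comp_quasiMeasurePreserving (quasiMeasurePreserving_sub μ μ)).mul hb.comp_snd

lemma lintegral_convolution_sq_le {a b : V → ℝ≥0∞} (ha : AEMeasurable a μ)
    (hb : AEMeasurable b μ) :
    ∫⁻ x, (∫⁻ y, a (x - y) * b y ∂μ) ^ 2 ∂μ ≤ (∫⁻ x, a x ∂μ) ^ 2 * ∫⁻ x, b x ^ 2 ∂μ := by
  have hpt (x : V) : (∫⁻ y, a (x - y) * b y ∂μ) ^ 2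
      ≤ (∫⁻ y, a y ∂μ) * ∫⁻ y, a (x - y) * b y ^ 2 ∂μ := by
    have hax : AEMeasurable (fun y => a (x - y)) μ :=
      ha.comp_quasiMeasurePreserving (quasiMeasurePreserving_sub_left μ x)
    have hhalf (t : ℝ≥0∞) : t ^ (1 / 2 : ℝ) * t ^ (1 / 2 : ℝ) = t := by
      rw [← ENNReal.rpow_add_of_nonneg _ _ (by norm_num) (by norm_num)]; norm_num
    have hsq (t : ℝ≥0∞) : (t ^ (1 / 2 : ℝ)) ^ (2 : ℝ) = t := by
      rw [← ENNReal.rpow_mul]; norm_num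
    have key := ENNReal.lintegral_mul_le_Lp_mul_Lq μ Real.HolderConjugate.two_two
      (hax.pow_const (1 / 2 : ℝ)) ((hax.pow_const (1 / 2 : ℝ)).mul hb)
    simp only [Pi.mul_apply, ← mul_assoc, hhalf, ENNReal.mul_rpow_of_nonneg _ _ zero_le_two,
      hsq] at key
    rw [lintegral_sub_left_eq_self a x] at key
    refine (ENNReal.pow_le_pow_left key).trans_eq ?_
    rw [mul_pow, ← ENNReal.rpow_two, ← ENNReal.rpow_two, hsq, hsq]
    simp only [ENNReal.rpow_two]
  have hb2 : AEMeasurable (fun y => b y ^ 2) μ := hb.pow_const 2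
  have hmeas := aemeasurable_convolution_integrand ha hb2
  calc ∫⁻ x, (∫⁻ y, a (x - y) * b y ∂μ) ^ 2 ∂μ
      ≤ ∫⁻ x, (∫⁻ y, a y ∂μ) * ∫⁻ y, a (x - y) * b y ^ 2 ∂μ ∂μ := lintegral_mono hpt
    _ = (∫⁻ y, a y ∂μ) * ∫⁻ y, ∫⁻ x, a (x - y) * b y ^ 2 ∂μ ∂μ := by
      rw [lintegral_const_mul'' _ hmeas.lintegral_prod_right', lintegral_lintegral_swap hmeas]
    _ = (∫⁻ y, a y ∂μ) * ∫⁻ y, (∫⁻ x, a x ∂μ) * b y ^ 2 ∂μ := by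
      congr 1
      refine lintegral_congr fun y => ?_
      rw [lintegral_mul_const'', lintegral_sub_right_eq_self a y]
      exact ha.comp_quasiMeasurePreserving (measurePreserving_sub_right μ y).quasiMeasurePreserving
    _ = _ := by rw [lintegral_const_mul'' _ hb2, sq, mul_assoc]

lemma ae_integrable_convolution_integrand {k η : V → ℂ} (hk : MemLp k 1 μ) (hη : MemLp η 2 μ) :
    ∀ᵐ x ∂μ, Integrable (fun y => k (x - y) * η y) μ := by
  have hbd := lintegral_convolution_sq_le hk.1.enorm hη.1.enorm
  have hfin : ∫⁻ x, (∫⁻ y, ‖k (x - y)‖ₑ * ‖η y‖ₑ ∂μ) ^ 2 ∂μ ≠ ∞ := by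
    refine (hbd.trans_lt (ENNReal.mul_lt_top (ENNReal.pow_lt_top ?_) ?_)).ne
    · simpa [eLpNorm_one_eq_lintegral_enorm] using hk.2
    · simpa using lintegral_rpow_enorm_lt_top_of_eLpNorm_lt_top two_ne_zero ENNReal.ofNat_ne_top
        hη.2
  have hmeas := aemeasurable_convolution_integrand hk.1.enorm hη.1.enorm
  filter_upwards [ae_lt_top' (hmeas.lintegral_prod_right'.pow_const 2) hfin] with x hx
  refine ⟨?_, ?_⟩
  · exact (hk.1.comp_quasiMeasurePreserving (quasiMeasurePreserving_sub_left μ x)).mul hη.1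
  · simp only [HasFiniteIntegral, enorm_mul]
    exact lt_of_not_ge fun h => by simp [top_le_iff.1 h] at hx

lemma aestronglyMeasurable_convolution {k η : V → ℂ} (hk : AEStronglyMeasurable k μ)
    (hη : AEStronglyMeasurable η μ) :
    AEStronglyMeasurable (fun x => ∫ y, k (x - y) * η y ∂μ) μ :=
  ((hk.comp_quasiMeasurePreserving (quasiMeasurePreserving_sub μ μ)).mul
    hη.comp_snd).integral_prod_right'

lemma eLpNorm_convolution_le {k η : V → ℂ} (hk : AEStronglyMeasurable k μ)
    (hη : AEStronglyMeasurable η μ) :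
    eLpNorm (fun x => ∫ y, k (x - y) * η y ∂μ) 2 μ ≤ eLpNorm k 1 μ * eLpNorm η 2 μ := by
  have h2 (g : V → ℂ) : eLpNorm g 2 μ ^ 2 = ∫⁻ x, ‖g x‖ₑ ^ 2 ∂μ := by
    simpa using eLpNorm_nnreal_pow_eq_lintegral (p := 2) (f := g) (μ := μ) two_ne_zero
  refine (ENNReal.pow_le_pow_left_iff two_ne_zero).1 ?_
  rw [mul_pow, h2, h2, eLpNorm_one_eq_lintegral_enorm]
  refine le_trans (lintegral_mono fun x => ?_) (lintegral_convolution_sq_le hk.enorm hη.enorm)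
  gcongr
  refine (enorm_integral_le_lintegral_enorm _).trans_eq ?_
  simp only [enorm_mul]

lemma memLp_convolution {k η : V → ℂ} (hk : MemLp k 1 μ) (hη : MemLp η 2 μ) :
    MemLp (fun x => ∫ y, k (x - y) * η y ∂μ) 2 μ :=
  ⟨aestronglyMeasurable_convolution hk.1 hη.1,
    (eLpNorm_convolution_le hk.1 hη.1).trans_lt (ENNReal.mul_lt_top hk.2 hη.2)⟩

lemma convolution_congr_left {k k' η : V → ℂ} (h : k =ᵐ[μ] k') (x : V) :
    ∫ y, k (x - y) * η y ∂μ = ∫ y, k' (x - y) * η y ∂μ := by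
  refine integral_congr_ae ?_
  filter_upwards [(quasiMeasurePreserving_sub_left μ x).ae h] with y hy
  rw [hy]

omit [NormedSpace ℝ V] [FiniteDimensional ℝ V] [BorelSpace V] [μ.IsAddHaarMeasure] in
lemma convolution_congr_right {k η η' : V → ℂ} (h : η =ᵐ[μ] η') (x : V) :
    ∫ y, k (x - y) * η y ∂μ = ∫ y, k (x - y) * η' y ∂μ := by
  refine integral_congr_ae ?_
  filter_upwards [h] with y hy
  rw [hy]

variable (μ) in
/-- Convolution as a bilinear map `L¹ × L² → L²`. -/
noncomputable def convolutionLpₗ : Lp ℂ 1 μ →ₗ[ℂ] Lp ℂ 2 μ →ₗ[ℂ] Lp ℂ 2 μ :=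
  LinearMap.mk₂ ℂ (fun k η => (memLp_convolution (Lp.memLp k) (Lp.memLp η)).toLp _)
    (fun k k' η => by
      rw [← MemLp.toLp_add]
      refine MemLp.toLp_congr _ _ ?_
      filter_upwards [ae_integrable_convolution_integrand (Lp.memLp k) (Lp.memLp η),
        ae_integrable_convolution_integrand (Lp.memLp k') (Lp.memLp η)] with x h h'
      rw [convolution_congr_left (Lp.coeFn_add k k'), Pi.add_apply, ← integral_add h h']
      simp only [Pi.add_apply, add_mul])
    (fun c k η => by
      rw [← MemLp.toLp_const_smul]
      refine MemLp.toLp_congr _ _ (ae_of_all _ fun x => ?_)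
      beta_reduce
      rw [convolution_congr_left (Lp.coeFn_smul c k), Pi.smul_apply, ← integral_smul]
      simp only [Pi.smul_apply, smul_mul_assoc])
    (fun k η η' => by
      rw [← MemLp.toLp_add]
      refine MemLp.toLp_congr _ _ ?_
      filter_upwards [ae_integrable_convolution_integrand (Lp.memLp k) (Lp.memLp η),
        ae_integrable_convolution_integrand (Lp.memLp k) (Lp.memLp η')] with x h h'
      rw [convolution_congr_right (Lp.coeFn_add η η'), Pi.add_apply, ← integral_add h h']
      simp only [Pi.add_apply, mul_add])
    (fun c k η => by
      rw [← MemLp.toLp_const_smul]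
      refine MemLp.toLp_congr _ _ (ae_of_all _ fun x => ?_)
      beta_reduce
      rw [convolution_congr_right (Lp.coeFn_smul c η), Pi.smul_apply, ← integral_smul]
      simp only [Pi.smul_apply, mul_smul_comm])

lemma coeFn_convolutionLpₗ (k : Lp ℂ 1 μ) (η : Lp ℂ 2 μ) :
    convolutionLpₗ μ k η =ᵐ[μ] fun x => ∫ y, k (x - y) * η y ∂μ :=
  (memLp_convolution (Lp.memLp k) (Lp.memLp η)).coeFn_toLp

lemma norm_convolutionLpₗ_le (k : Lp ℂ 1 μ) (η : Lp ℂ 2 μ) :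
    ‖convolutionLpₗ μ k η‖ ≤ 1 * ‖k‖ * ‖η‖ := by
  rw [one_mul, Lp.norm_def, Lp.norm_def, Lp.norm_def, ← ENNReal.toReal_mul,
    eLpNorm_congr_ae (coeFn_convolutionLpₗ k η)]
  exact ENNReal.toReal_mono (ENNReal.mul_ne_top (Lp.eLpNorm_ne_top k) (Lp.eLpNorm_ne_top η))
    (eLpNorm_convolution_le (Lp.memLp k).1 (Lp.memLp η).1)

variable (μ) in
/-- Convolution as a continuous bilinear map `L¹ × L² → L²`. -/
noncomputable def convolutionLp : Lp ℂ 1 μ →L[ℂ] Lp ℂ 2 μ →L[ℂ] Lp ℂ 2 μ :=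
  (convolutionLpₗ μ).mkContinuous₂ 1 norm_convolutionLpₗ_le

lemma coeFn_convolutionLp (k : Lp ℂ 1 μ) (η : Lp ℂ 2 μ) :
    convolutionLp μ k η =ᵐ[μ] fun x => ∫ y, k (x - y) * η y ∂μ :=
  coeFn_convolutionLpₗ k η

end

section
variable {α E : Type*} [MeasurableSpace α] (μ : Measure α)
  [NormedAddCommGroup E] [NormedSpace ℂ E]

/-- The operator `e ↦ (x ↦ F x e)` from `E` to `L²` attached to a square-integrable family `F` of
continuous linear functionals on `E`. -/
noncomputable def hilbertSchmidtOperator : Lp (E →L[ℂ] ℂ) 2 μ →L[ℂ] E →L[ℂ] Lp ℂ 2 μ :=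
  ((ContinuousLinearMap.id ℂ (E →L[ℂ] ℂ)).flip.compLpL₂ 2 μ).flip

variable {μ}

lemma coeFn_hilbertSchmidtOperator (F : Lp (E →L[ℂ] ℂ) 2 μ) (e : E) :
    hilbertSchmidtOperator μ F e =ᵐ[μ] fun x => F x e :=
  ContinuousLinearMap.coeFn_compLp _ F

lemma isCompactOperator_hilbertSchmidtOperator (F : Lp (E →L[ℂ] ℂ) 2 μ) :
    IsCompactOperator (hilbertSchmidtOperator μ F) := by
  induction F using Lp.induction (ENNReal.ofNat_ne_top (n := 2)) with
  | indicatorConst φ hs hμs =>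
    rename_i s
    have : hilbertSchmidtOperator μ (indicatorConstLp 2 hs hμs.ne φ) =
        (ContinuousLinearMap.toSpanSingleton ℂ (indicatorConstLp 2 hs hμs.ne (1 : ℂ))) ∘L φ := by
      ext e
      filter_upwards [coeFn_hilbertSchmidtOperator (indicatorConstLp 2 hs hμs.ne φ) e,
        indicatorConstLp_coeFn (p := 2) (hs := hs) (hμs := hμs.ne) (c := φ),
        indicatorConstLp_coeFn (p := 2) (hs := hs) (hμs := hμs.ne) (c := (1 : ℂ)),
        Lp.coeFn_smul (φ e) (indicatorConstLp 2 hs hμs.ne (1 : ℂ))] with x h1 h2 h3 h4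
      rw [h1, h2]
      simp only [ContinuousLinearMap.comp_apply, ContinuousLinearMap.toSpanSingleton_apply, h4,
        Pi.smul_apply, h3]
      by_cases hx : x ∈ s <;> simp [hx]
    rw [Lp.simpleFunc.coe_indicatorConst, this]
    exact (isCompactOperator_of_locallyCompactSpace_dom φ).clm_comp
      (ContinuousLinearMap.toSpanSingleton ℂ (indicatorConstLp 2 hs hμs.ne (1 : ℂ)))
  | add hf hg _ h₁ h₂ => rw [map_add]; exact h₁.add h₂
  | isClosed =>
    exact isClosed_setOfPred_isCompactOperator.preimage (hilbertSchmidtOperator μ).continuous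

end

section
variable {α : Type*} [MeasurableSpace α] (μ : Measure α)

/-- Multiplication by essentially bounded functions, as operators on `L²`. -/
noncomputable def multiplicationLp : Lp ℂ ∞ μ →L[ℂ] Lp ℂ 2 μ →L[ℂ] Lp ℂ 2 μ :=
  (ContinuousLinearMap.mul ℂ ℂ).holderL μ ∞ 2 2

variable {μ}

lemma coeFn_multiplicationLp (f : Lp ℂ ∞ μ) (η : Lp ℂ 2 μ) :
    multiplicationLp μ f η =ᵐ[μ] fun x => f x * η x :=
  (ContinuousLinearMap.mul ℂ ℂ).coeFn_holder f η

end

section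
variable {V : Type*} [NormedAddCommGroup V] [NormedSpace ℝ V] [FiniteDimensional ℝ V]
  [MeasurableSpace V] [BorelSpace V] {μ : Measure V} [μ.IsAddHaarMeasure]

lemma coeFn_multiplicationLp_comp_convolutionLp {f k : V → ℂ} (hf : MemLp f ∞ μ)
    (hk : MemLp k 1 μ) (η : Lp ℂ 2 μ) :
    (multiplicationLp μ (hf.toLp f) ∘L convolutionLp μ (hk.toLp k)) η
      =ᵐ[μ] fun x => f x * ∫ y, k (x - y) * η y ∂μ := by
  filter_upwards [coeFn_multiplicationLp (hf.toLp f) (convolutionLp μ (hk.toLp k) η),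
    coeFn_convolutionLp (hk.toLp k) η, hf.coeFn_toLp] with x h1 h2 h3
  rw [ContinuousLinearMap.comp_apply, h1, h2, h3, convolution_congr_left hk.coeFn_toLp]

lemma isCompactOperator_multiplicationLp_comp_convolutionLp_of_memLp_two {f k : V → ℂ}
    (hf : MemLp f ∞ μ) (hf2 : MemLp f 2 μ) (hk : MemLp k 1 μ) (hk2 : MemLp k 2 μ) :
    IsCompactOperator (multiplicationLp μ (hf.toLp f) ∘L convolutionLp μ (hk.toLp k)) := by
  have hg : MemLp (fun y => k (-y)) 2 μ :=
    hk2.comp_measurePreserving (Measure.measurePreserving_neg μ)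
  let G (x : V) : Lp ℂ 2 μ := DomAddAct.mk (-x) +ᵥ hg.toLp
  have hG : Continuous G := by
    have h : Continuous fun x : V => DomAddAct.mk (-x) :=
      DomAddAct.continuous_mk.comp continuous_neg
    have : Fact ((2 : ℝ≥0∞) ≠ ∞) := ⟨ENNReal.ofNat_ne_top⟩
    exact h.vadd continuous_const
  have hG_coe (x : V) : G x =ᵐ[μ] fun y => k (x - y) := by
    simp only [G, DomAddAct.mk_vadd_toLp]
    refine (MemLp.coeFn_toLp _).trans (ae_of_all _ fun y => ?_)
    simp [sub_eq_add_neg, add_comm]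
  have hG_norm (x : V) : ‖G x‖ = ‖hg.toLp‖ := Lp.norm_compMeasurePreserving _ _
  let Φ : Lp ℂ 2 μ →L[ℂ] Lp ℂ 2 μ →L[ℂ] ℂ := (ContinuousLinearMap.mul ℂ ℂ).lpPairing μ 2 2
  have hF : MemLp (fun x => f x • Φ (G x)) 2 μ := by
    refine hf2.of_le_mul (c := ‖Φ‖ * ‖hg.toLp‖)
      (hf2.1.smul (Φ.continuous.comp hG).aestronglyMeasurable) (ae_of_all _ fun x => ?_)
    rw [norm_smul, mul_comm, ← hG_norm x]
    gcongr
    exact Φ.le_opNorm _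
  have : multiplicationLp μ (hf.toLp f) ∘L convolutionLp μ (hk.toLp k) =
      hilbertSchmidtOperator μ hF.toLp := by
    ext η
    filter_upwards [coeFn_multiplicationLp_comp_convolutionLp hf hk η,
      coeFn_hilbertSchmidtOperator hF.toLp η, hF.coeFn_toLp] with x h1 h2 h3
    rw [h1, h2, h3, smul_apply, smul_eq_mul, ContinuousLinearMap.lpPairing_eq_integral]
    congr 1
    refine integral_congr_ae ?_
    filter_upwards [hG_coe x] with y hy
    rw [hy, ContinuousLinearMap.mul_apply']
  rw [this]
  exact isCompactOperator_hilbertSchmidtOperator _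

lemma isCompactOperator_multiplicationLp_comp_convolutionLp_of_memLp_two_left {f : V → ℂ}
    (hf : MemLp f ∞ μ) (hf2 : MemLp f 2 μ) (k : Lp ℂ 1 μ) :
    IsCompactOperator (multiplicationLp μ (hf.toLp f) ∘L convolutionLp μ k) := by
  induction k using Lp.induction ENNReal.one_ne_top with
  | indicatorConst c hs hμs =>
    exact isCompactOperator_multiplicationLp_comp_convolutionLp_of_memLp_two hf hf2
      (memLp_indicator_const 1 hs c (.inr hμs.ne)) (memLp_indicator_const 2 hs c (.inr hμs.ne))
  | add hf hg _ h₁ h₂ =>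
    rw [map_add, ContinuousLinearMap.comp_add]
    exact h₁.add h₂
  | isClosed =>
    exact isClosed_setOfPred_isCompactOperator.preimage
      (continuous_const.clm_comp (convolutionLp μ).continuous)

omit [NormedSpace ℝ V] [FiniteDimensional ℝ V] [μ.IsAddHaarMeasure] in
lemma memLp_top_of_tendsto_cocompact {f : V → ℂ} (hf : Continuous f)
    (hf0 : Tendsto f (cocompact V) (nhds 0)) : MemLp f ∞ μ := by
  let f₀ : ZeroAtInftyContinuousMap V ℂ := ⟨⟨f, hf⟩, hf0⟩
  exact memLp_top_of_bound hf.aestronglyMeasurable ‖f₀.toBCF‖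
    (ae_of_all _ f₀.toBCF.norm_coe_le_norm)

lemma isCompactOperator_multiplicationLp_comp_convolutionLp {f : V → ℂ} (hf : Continuous f)
    (hf0 : Tendsto f (cocompact V) (nhds 0)) (k : Lp ℂ 1 μ) :
    IsCompactOperator (multiplicationLp μ
      ((memLp_top_of_tendsto_cocompact hf hf0).toLp f) ∘L convolutionLp μ k) := by
  have hf' : MemLp f ∞ μ := memLp_top_of_tendsto_cocompact hf hf0
  have hclosed : IsClosed {g : Lp ℂ ∞ μ |
      IsCompactOperator (multiplicationLp μ g ∘L convolutionLp μ k)} :=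
    isClosed_setOfPred_isCompactOperator.preimage
      ((multiplicationLp μ).continuous.clm_comp continuous_const)
  refine hclosed.closure_subset (Metric.mem_closure_iff.2 fun ε hε => ?_)
  obtain ⟨K, hK, hKf⟩ := mem_cocompact.1 (hf0 (Metric.ball_mem_nhds 0 (half_pos hε)))
  have hKm : MeasurableSet K := hK.isClosed.measurableSet
  have hg : MemLp (K.indicator f) ∞ μ := hf'.indicator hKm
  have hg2 : MemLp (K.indicator f) 2 μ := by
    have : IsFiniteMeasure (μ.restrict K) := ⟨by simpa using hK.measure_lt_top⟩
    exact (memLp_indicator_iff_restrict hKm).2 ((hf'.restrict K).mono_exponent le_top)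
  refine ⟨hg.toLp, isCompactOperator_multiplicationLp_comp_convolutionLp_of_memLp_two_left
    hg hg2 k, ?_⟩
  rw [dist_eq_norm, ← MemLp.toLp_sub, Lp.norm_toLp]
  refine (ENNReal.toReal_le_of_le_ofReal (half_pos hε).le ?_).trans_lt (half_lt_self hε)
  rw [eLpNorm_exponent_top]
  refine eLpNormEssSup_le_of_ae_bound (ae_of_all _ fun x => ?_)
  by_cases hx : x ∈ K
  · simpa [hx] using (half_pos hε).le
  · simpa [hx] using (mem_ball_zero_iff.1 (hKf hx)).le

end

/-- **Theorem A.4**: for `f` a continuous function vanishing at infinity and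
`k ∈ L¹(ℝⁿ)`, the bounded operator `η ↦ f · (k ∗ η)` on `L²(ℝⁿ)` is compact. -/
theorem multiplication_comp_convolution_isCompactOperator
    (n : ℕ) (k : EuclideanSpace ℝ (Fin n) → ℂ)
    (hk : Integrable k (volume : Measure (EuclideanSpace ℝ (Fin n))))
    (f : EuclideanSpace ℝ (Fin n) → ℂ) (hf : Continuous f)
    (hf0 : Tendsto f (cocompact (EuclideanSpace ℝ (Fin n))) (nhds 0)) :
    ∃ T : Lp ℂ 2 (volume : Measure (EuclideanSpace ℝ (Fin n))) →L[ℂ]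
          Lp ℂ 2 (volume : Measure (EuclideanSpace ℝ (Fin n))),
      IsCompactOperator T ∧
      ∀ η : Lp ℂ 2 (volume : Measure (EuclideanSpace ℝ (Fin n))),
        (T η : EuclideanSpace ℝ (Fin n) → ℂ)
          =ᵐ[volume] fun x => f x * ∫ y, k (x - y) * η y := by
  have hk' := memLp_one_iff_integrable.2 hk
  exact ⟨_, isCompactOperator_multiplicationLp_comp_convolutionLp hf hf0 (hk'.toLp k),
    coeFn_multiplicationLp_comp_convolutionLp _ hk'⟩
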